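/- Let n ≥ 3 be odd. The induced (n-1)-independent graph H_{n-1}(CL_n) of the circular ladder graph CL_n is isomorphic (as a simple graph) to CL_n itself. -/

import Mathlib

/-- A finite set of vertices is independent if no two of its elements are adjacent. -/
def IsIndep {V : Type*} (G : SimpleGraph V) (S : Finset V) : Prop :=
  ∀ v ∈ S, ∀ w ∈ S, ¬ G.Adj v w

/-- The induced `k`-independent graph of `G`: vertices are the independent sets of
size `k` in `G`, two of them adjacent iff they are disjoint. -/
def Hk {V : Type*} (G : SimpleGraph V) (k : ℕ) :
    SimpleGraph {S : Finset V // S.card = k ∧ IsIndep G S} :=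
  SimpleGraph.fromRel (fun S T => Disjoint S.1 T.1)

/-- The circular ladder graph `CL n` on `ZMod n × Bool`: `(i,b)` and `(j,c)` are adjacent
iff either `b = c` and (`j = i + 1` or `j = i - 1`), or `i = j` and `b ≠ c`. -/
def CL (n : ℕ) : SimpleGraph (ZMod n × Bool) :=
  SimpleGraph.fromRel (fun v w =>
    (v.2 = w.2 ∧ (w.1 = v.1 + 1 ∨ w.1 = v.1 - 1)) ∨ (v.1 = w.1 ∧ v.2 ≠ w.2))

lemma CL_adj {n : ℕ} (hn : 3 ≤ n) (i j : ZMod n) (b c : Bool) :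
    (CL n).Adj (i, b) (j, c) ↔
      (b = c ∧ (j = i + 1 ∨ j = i - 1)) ∨ (i = j ∧ b ≠ c) := by
  have : Fact (1 < n) := ⟨by omega⟩
  simp only [CL, SimpleGraph.fromRel_adj]
  constructor
  · rintro ⟨_, h | h⟩
    · exact h
    · rcases h with ⟨h1, h2 | h2⟩ | ⟨h1, h2⟩
      · exact Or.inl ⟨h1.symm, Or.inr (by rw [h2]; ring)⟩
      · exact Or.inl ⟨h1.symm, Or.inl (by rw [h2]; ring)⟩
      · exact Or.inr ⟨h1.symm, h2.symm⟩
  · intro h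
    refine ⟨?_, Or.inl h⟩
    rintro h'
    obtain ⟨rfl, rfl⟩ := Prod.mk.inj h'
    rcases h with ⟨_, h2 | h2⟩ | ⟨_, h2⟩
    · simp at h2
    · have : (1 : ZMod n) = 0 := by linear_combination h2
      exact one_ne_zero this
    · exact h2 rfl

/-- parity of the representative -/
def par {n : ℕ} (x : ZMod n) : Bool := decide (x.val % 2 = 1)

lemma par_sub_le {n : ℕ} [NeZero n] (u d : ZMod n) (h : d.val ≤ u.val) :
    par (u - d) = xor (par u) (par d) := by
  unfold par
  rw [ZMod.val_sub h]
  rcases Nat.mod_two_eq_zero_or_one u.val with h1 | h1 <;>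
  rcases Nat.mod_two_eq_zero_or_one d.val with h2 | h2 <;>
  simp [h1, h2] <;> omega

lemma par_sub_lt {n : ℕ} [NeZero n] (hodd : Odd n) (u d : ZMod n) (h : u.val < d.val) :
    par (u - d) = !(xor (par u) (par d)) := by
  have h3 : (u - d).val = n - (d.val - u.val) := by
    have hneg : u - d = -(d - u) := by ring
    have h0 : d - u ≠ 0 := by
      intro h0
      rw [sub_eq_zero] at h0
      rw [h0] at h; exact lt_irrefl _ h
    have : NeZero (d - u) := ⟨h0⟩
    rw [hneg, ZMod.val_neg_of_ne_zero, ZMod.val_sub h.le]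
  have h4 := ZMod.val_lt d
  have h5 := Nat.odd_iff.mp hodd
  unfold par
  rw [h3]
  rcases Nat.mod_two_eq_zero_or_one u.val with h1 | h1 <;>
  rcases Nat.mod_two_eq_zero_or_one d.val with h2 | h2 <;>
  simp [h1, h2] <;> omega

lemma val_m1 {n : ℕ} (hn : 3 ≤ n) : (-1 : ZMod n).val = n - 1 := by
  obtain ⟨m, rfl⟩ : ∃ m, n = m + 1 := ⟨n - 1, by omega⟩
  simpa using ZMod.val_neg_one m

lemma val_p1 {n : ℕ} (hn : 3 ≤ n) : (1 : ZMod n).val = 1 := by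
  have : Fact (1 < n) := ⟨by omega⟩
  exact ZMod.val_one n

/-- the independent set -/
def SS {n : ℕ} [NeZero n] (i : ZMod n) (b : Bool) : Finset (ZMod n × Bool) :=
  (Finset.univ.erase i).image (fun j => (j, xor b (par (j - i))))

lemma mem_SS {n : ℕ} [NeZero n] (i : ZMod n) (b : Bool) (j : ZMod n) (c : Bool) :
    (j, c) ∈ SS i b ↔ j ≠ i ∧ c = xor b (par (j - i)) := by
  simp only [SS, Finset.mem_image, Finset.mem_erase, Finset.mem_univ, Prod.mk.injEq]
  constructor
  · rintro ⟨a, h, rfl, rfl⟩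
    exact ⟨h.1, rfl⟩
  · rintro ⟨h, rfl⟩
    exact ⟨j, ⟨h, trivial⟩, rfl, rfl⟩

lemma card_SS {n : ℕ} [NeZero n] (i : ZMod n) (b : Bool) : (SS i b).card = n - 1 := by
  unfold SS
  rw [Finset.card_image_of_injective _ (fun x y h => (Prod.mk.inj h).1),
    Finset.card_erase_of_mem (Finset.mem_univ _), Finset.card_univ, ZMod.card]

lemma par_step {n : ℕ} [NeZero n] (hn : 3 ≤ n) (x : ZMod n) (h : x ≠ 0) :
    par (x - 1) = !(par x) := by
  have h1 : x.val ≠ 0 := by simpa [ZMod.val_eq_zero] using h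
  rw [par_sub_le x 1 (by rw [val_p1 hn]; omega)]
  have : par (1 : ZMod n) = true := by simp [par, val_p1 hn]
  rw [this]; simp

lemma indep_SS {n : ℕ} [NeZero n] (hn : 3 ≤ n) (i : ZMod n) (b : Bool) :
    IsIndep (CL n) (SS i b) := by
  rintro ⟨j, c⟩ h ⟨k, d⟩ h' hadj
  rw [mem_SS] at h h'
  rw [CL_adj hn] at hadj
  obtain ⟨hj, rfl⟩ := h
  obtain ⟨hk, rfl⟩ := h'
  rcases hadj with ⟨h1, rfl | rfl⟩ | ⟨rfl, h1⟩
  · have := par_step hn (j + 1 - i) (sub_ne_zero.mpr hk)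
    rw [show j + 1 - i - 1 = j - i by ring] at this
    rw [this] at h1
    simp at h1
  · have := par_step hn (j - i) (sub_ne_zero.mpr hj)
    rw [show j - i - 1 = j - 1 - i by ring] at this
    rw [this] at h1
    simp at h1
  · exact h1 rfl

lemma disj_SS {n : ℕ} [NeZero n] (hn : 3 ≤ n) (hodd : Odd n) (i j : ZMod n) (b c : Bool) :
    Disjoint (SS i b) (SS j c) ↔ (CL n).Adj (i, b) (j, c) := by
  rw [CL_adj hn]
  have key : Disjoint (SS i b) (SS j c) ↔
      ∀ u : ZMod n, u ≠ 0 → u ≠ j - i → xor b (par u) ≠ xor c (par (u - (j - i))) := by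
    rw [Finset.disjoint_left]
    constructor
    · intro h u h0 h1 h2
      apply @h (u + i, xor b (par u))
      · rw [mem_SS]; simpa using h0
      · rw [mem_SS]
        refine ⟨fun h => h1 (by rw [← h]; ring), ?_⟩
        rw [h2]; congr 2; ring
    · rintro h ⟨x, e⟩ h1 h2
      rw [mem_SS] at h1 h2
      apply h (x - i) (sub_ne_zero.mpr h1.1) (fun h => h2.1 (by simpa using h))
      rw [← h1.2, h2.2]; congr 2; ring
  rw [key]
  have v1 := val_p1 hn
  have vm := val_m1 hn
  have n2 := Nat.odd_iff.mp hodd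
  have p1 : par (1 : ZMod n) = true := by simp [par, v1]
  have pm : par (-1 : ZMod n) = false := by simp [par, vm]; omega
  have one0 : (1 : ZMod n) ≠ 0 := by intro h; rw [h] at v1; simp at v1
  have m0 : (-1 : ZMod n) ≠ 0 := neg_ne_zero.mpr one0
  have m1 : (-1 : ZMod n) ≠ 1 := by intro h; rw [h] at vm; omega
  obtain ⟨d, rfl⟩ : ∃ d, j = i + d := ⟨j - i, by ring⟩
  rw [show i + d - i = d by ring]
  constructor
  · intro h
    by_cases d0 : d = 0
    · subst d0
      right
      have := h 1 one0 one0
      simp at this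
      simpa using this
    left
    have dv : d.val ≠ 0 := by simpa [ZMod.val_eq_zero] using d0
    have dlt := ZMod.val_lt d
    by_cases d1 : d = 1
    · subst d1
      have := h (-1) m0 m1
      rw [par_sub_le _ _ (by omega), p1, pm] at this
      refine ⟨?_, Or.inl rfl⟩
      revert this; cases b <;> cases c <;> simp
    by_cases d2 : d = -1
    · subst d2
      have := h 1 one0 m1.symm
      rw [par_sub_lt hodd _ _ (by omega), p1, pm] at this
      refine ⟨?_, Or.inr (by ring)⟩
      revert this; cases b <;> cases c <;> simp
    exfalso
    have e1 : d.val ≠ 1 := fun e => d1 (ZMod.val_injective n (by rw [e, v1]))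
    have h1 := h 1 one0 (Ne.symm d1)
    have h2 := h (-1) m0 (Ne.symm d2)
    rw [par_sub_lt hodd _ _ (by omega), p1] at h1
    rw [par_sub_le _ _ (by omega), pm] at h2
    revert h1 h2
    cases b <;> cases c <;> cases par d <;> simp
  · rintro (⟨rfl, h | h⟩ | ⟨h, hbc⟩) u u0 ud
    · have : d = 1 := by simpa using h
      subst this
      rw [par_step hn u u0]; simp
    · have : d = -1 := by linear_combination h
      subst this
      have := par_step hn (u - -1) (sub_ne_zero.mpr ud)
      rw [show u - -1 - 1 = u by ring] at this
      rw [this]; simp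
    · have : d = 0 := by simpa using h
      subst this
      simpa using hbc

lemma surj_SS {n : ℕ} [NeZero n] (hn : 3 ≤ n) (S : Finset (ZMod n × Bool))
    (hc : S.card = n - 1) (hS : IsIndep (CL n) S) : ∃ i b, SS i b = S := by
  have hinj : Set.InjOn Prod.fst (S : Set (ZMod n × Bool)) := by
    rintro ⟨x, e⟩ h ⟨y, f⟩ h' (rfl : x = y)
    by_contra hne
    refine hS _ h _ h' ((CL_adj hn _ _ _ _).mpr (Or.inr ⟨rfl, ?_⟩))
    rintro rfl; exact hne rfl
  have h1 : (S.image Prod.fst)ᶜ.card = 1 := by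
    rw [Finset.card_compl, Finset.card_image_of_injOn hinj, hc, ZMod.card]; omega
  obtain ⟨i, hi⟩ := Finset.card_eq_one.mp h1
  have hex : ∀ j, j ≠ i → ∃ c, (j, c) ∈ S := by
    intro j hj
    have : j ∉ (S.image Prod.fst)ᶜ := by rw [hi]; simpa using hj
    rw [Finset.mem_compl, not_not, Finset.mem_image] at this
    obtain ⟨⟨x, e⟩, h, rfl⟩ := this
    exact ⟨e, h⟩
  have one0 : (1 : ZMod n) ≠ 0 := by intro h; have := val_p1 hn; rw [h] at this; simp at this
  obtain ⟨c, hc1⟩ := hex (i + 1) (by simpa using one0)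
  refine ⟨i, !c, ?_⟩
  have ind : ∀ k : ℕ, k + 1 < n →
      (i + ((k + 1 : ℕ) : ZMod n), xor (!c) (par ((k + 1 : ℕ) : ZMod n))) ∈ S := by
    intro k
    induction k with
    | zero =>
      intro _
      have : par (1 : ZMod n) = true := by simp [par, val_p1 hn]
      simpa [this] using hc1
    | succ k ih =>
      intro hk
      have hm := ih (by omega)
      have hne : (((k + 1 + 1 : ℕ) : ZMod n)) ≠ 0 := by
        intro h
        have := ZMod.val_cast_of_lt hk
        rw [h] at this; simp at this
      obtain ⟨e, he⟩ := hex (i + ((k + 1 + 1 : ℕ) : ZMod n)) (by simpa using hne)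
      have hp := par_step hn _ hne
      rw [show (((k + 1 + 1 : ℕ) : ZMod n)) - 1 = ((k + 1 : ℕ) : ZMod n) by push_cast; ring] at hp
      have hna := hS _ hm _ he
      rw [CL_adj hn] at hna
      have : xor (!c) (par ((k + 1 : ℕ) : ZMod n)) ≠ e := by
        intro h
        exact hna (Or.inl ⟨h, Or.inl (by push_cast; ring)⟩)
      rw [hp] at this
      convert he using 2
      revert this
      cases c <;> cases e <;> cases par ((k + 1 + 1 : ℕ) : ZMod n) <;> simp
  apply Finset.eq_of_subset_of_card_le
  · rintro ⟨j, e⟩ h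
    rw [mem_SS] at h
    obtain ⟨hj, rfl⟩ := h
    have hv : (j - i).val ≠ 0 := by simpa [ZMod.val_eq_zero, sub_eq_zero] using hj
    have hl := ZMod.val_lt (j - i)
    have := ind ((j - i).val - 1) (by omega)
    rw [show (j - i).val - 1 + 1 = (j - i).val by omega, ZMod.natCast_zmod_val] at this
    simpa using this
  · rw [hc, card_SS]

lemma inj_SS {n : ℕ} [NeZero n] (hn : 3 ≤ n) {i j : ZMod n} {b c : Bool}
    (h : SS i b = SS j c) : i = j ∧ b = c := by
  have one0 : (1 : ZMod n) ≠ 0 := by intro h; have := val_p1 hn; rw [h] at this; simp at this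
  have hij : i = j := by
    by_contra hne
    have : (i, xor c (par (i - j))) ∈ SS i b := by rw [h, mem_SS]; exact ⟨hne, rfl⟩
    rw [mem_SS] at this
    exact this.1 rfl
  subst hij
  refine ⟨rfl, ?_⟩
  have : (i + 1, xor b (par (i + 1 - i))) ∈ SS i c := by
    rw [← h, mem_SS]; exact ⟨by simpa using one0, rfl⟩
  rw [mem_SS] at this
  simpa using this.2

/-- For odd `n ≥ 3`, the induced `(n-1)`-independent graph of the circular ladder
graph `CL n` is isomorphic to `CL n` itself. -/
theorem stmt_0 (n : ℕ) (hn : 3 ≤ n) (hodd : Odd n) :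
    Nonempty (Hk (CL n) (n - 1) ≃g CL n) := by
  have : NeZero n := ⟨by omega⟩
  let f : ZMod n × Bool → {S : Finset (ZMod n × Bool) // S.card = n - 1 ∧ IsIndep (CL n) S} :=
    fun v => ⟨SS v.1 v.2, card_SS _ _, indep_SS hn _ _⟩
  have hf : Function.Bijective f := by
    constructor
    · rintro ⟨i, b⟩ ⟨j, c⟩ h
      have := inj_SS hn (congrArg Subtype.val h)
      exact Prod.ext this.1 this.2
    · rintro ⟨S, hc, hS⟩
      obtain ⟨i, b, h⟩ := surj_SS hn S hc hS
      exact ⟨(i, b), Subtype.ext h⟩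
  refine ⟨RelIso.symm ⟨Equiv.ofBijective f hf, ?_⟩⟩
  rintro ⟨i, b⟩ ⟨j, c⟩
  simp only [Equiv.ofBijective_apply, Hk, SimpleGraph.fromRel_adj]
  have e1 : Disjoint (f (i, b)).1 (f (j, c)).1 ↔ (CL n).Adj (i, b) (j, c) :=
    disj_SS hn hodd i j b c
  have e2 : Disjoint (f (j, c)).1 (f (i, b)).1 ↔ (CL n).Adj (j, c) (i, b) :=
    disj_SS hn hodd j i c b
  rw [e1, e2, (CL n).adj_comm (j, c), or_self, hf.1.ne_iff]
  exact ⟨fun h => h.2, fun h => ⟨h.ne, h⟩⟩
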